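/- arXiv:2310.09500 — 4 statements merged into one kernel-verified Lean document; each statement's English description precedes it below -/
import Mathlib

section
/- Let (B, ψ, A) be a d-regular quantum graph such that both A and A† are real (*-preserving). Then ‖A‖_op = d on L²(B, ψ). In particular this holds when A is real and ψ is tracial. -/
open TensorProduct

/-- Linear extension of `x ⊗ y ↦ ψ(b·x)·ψ(c·y)` (GNS pairing on the tensor square). -/
noncomputable def pairQ (B : Type*) [Ring B] [Algebra ℂ B]
    (ψ : B →ₗ[ℂ] ℂ) (b c : B) : TensorProduct ℂ B B →ₗ[ℂ] ℂ :=
  TensorProduct.lift ((LinearMap.mul ℂ ℂ).compl₁₂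
    (ψ ∘ₗ LinearMap.mulLeft ℂ b) (ψ ∘ₗ LinearMap.mulLeft ℂ c))

/-- A finite-dimensional space with a definite inner product has an orthonormal expansion. -/
lemma exists_expansion (V : Type*) [AddCommGroup V] [Module ℂ V] [FiniteDimensional ℂ V]
    (c : InnerProductSpace.Core ℂ V) :
    ∃ (n : ℕ) (e : Fin n → V), ∀ y : V, ∑ i, (c.inner (e i) y) • e i = y := by
  letI := c.toNormedAddCommGroup
  letI : InnerProductSpace ℂ V := InnerProductSpace.ofCore c.toCore
  exact ⟨_, stdOrthonormalBasis ℂ V, fun y => (stdOrthonormalBasis ℂ V).sum_repr' y⟩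

lemma psi_star (B : Type*) [Ring B] [StarRing B] [Algebra ℂ B] [StarModule ℂ B]
    (ψ : B →ₗ[ℂ] ℂ) (h : ∀ x : B, (ψ (star x * x)).im = 0) (x : B) :
    ψ (star x) = star (ψ x) := by
  have h0 := h 1
  have h1 := h (x + 1)
  have h2 := h (x + Complex.I • 1)
  have h3 := h x
  simp [add_mul, mul_add, star_add, star_smul, h3] at h0 h1 h2
  apply Complex.ext
  · simp
    linarith
  · simp
    linarith

lemma exists_basis (B : Type*) [Ring B] [StarRing B] [Algebra ℂ B]
    [StarModule ℂ B] [FiniteDimensional ℂ B] (ψ : B →ₗ[ℂ] ℂ)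
    (hψpos : ∀ x : B, 0 ≤ (ψ (star x * x)).re ∧ (ψ (star x * x)).im = 0)
    (hψfaith : ∀ x : B, ψ (star x * x) = 0 → x = 0) :
    ∃ (n : ℕ) (e : Fin n → B), ∀ y : B, ∑ i, ψ (star (e i) * y) • e i = y :=
  exists_expansion B
    { inner := fun x y => ψ (star x * y)
      conj_inner_symm := fun x y => by
        have := psi_star B ψ (fun x => (hψpos x).2) (star y * x)
        simp only [star_mul, star_star] at this
        exact this.symm
      re_inner_nonneg := fun x => (hψpos x).1
      add_left := fun x y z => by simp [add_mul]
      smul_left := fun x y r => by simp [star_smul]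
      definite := fun x h => hψfaith x h }

lemma pairQ_tmul (B : Type*) [Ring B] [Algebra ℂ B] (ψ : B →ₗ[ℂ] ℂ) (b c x y : B) :
    pairQ B ψ b c (x ⊗ₜ y) = ψ (b * x) * ψ (c * y) := by
  simp [pairQ]

lemma pairQ_expand (B : Type*) [Ring B] [StarRing B] [Algebra ℂ B] (ψ : B →ₗ[ℂ] ℂ)
    {n : ℕ} (e : Fin n → B) (he : ∀ y : B, ∑ i, ψ (star (e i) * y) • e i = y)
    (t : TensorProduct ℂ B B) :
    ∑ i, ∑ j, pairQ B ψ (star (e i)) (star (e j)) t • (e i ⊗ₜ[ℂ] e j) = t := by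
  induction t with
  | zero => simp
  | add x y hx hy =>
    simp only [map_add, add_smul, Finset.sum_add_distrib, hx, hy]
  | tmul x y =>
    conv_rhs => rw [← he x, ← he y]
    simp only [pairQ_tmul, TensorProduct.sum_tmul, TensorProduct.tmul_sum,
      TensorProduct.smul_tmul_smul]
    exact Finset.sum_comm

lemma mdag_formula (B : Type*) [Ring B] [StarRing B] [Algebra ℂ B] [StarModule ℂ B]
    (ψ : B →ₗ[ℂ] ℂ) (hs : ∀ x, ψ (star x) = star (ψ x))
    {n : ℕ} (e : Fin n → B) (he : ∀ y : B, ∑ i, ψ (star (e i) * y) • e i = y)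
    (mdag : B →ₗ[ℂ] TensorProduct ℂ B B)
    (hmdag : ∀ a b c : B, pairQ B ψ (star b) (star c) (mdag a) = ψ (star (b * c) * a))
    (x y : B) :
    mdag (y * x) = ∑ i, (y * e i) ⊗ₜ[ℂ] (star (e i) * x) := by
  rw [← pairQ_expand B ψ e he (mdag (y * x)),
    ← pairQ_expand B ψ e he (∑ i, (y * e i) ⊗ₜ[ℂ] (star (e i) * x))]
  refine Finset.sum_congr rfl fun j _ => Finset.sum_congr rfl fun k _ => ?_
  congr 1
  rw [hmdag, map_sum]
  simp only [pairQ_tmul]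
  have key : ∑ i, ψ (star (e j) * (y * e i)) • star (e i) = star (e j) * y := by
    have := congrArg star (he (star y * e j))
    rw [star_sum] at this
    simp only [star_smul, star_mul, star_star] at this
    rw [← this]
    refine Finset.sum_congr rfl fun i _ => ?_
    rw [← hs]
    simp [mul_assoc]
  calc ψ (star (e j * e k) * (y * x)) = ψ (star (e k) * ((star (e j) * y) * x)) := by
        simp [mul_assoc]
    _ = _ := by
        rw [← key]
        simp [Finset.sum_mul, Finset.mul_sum]

/-- For a `d`-regular quantum graph `(B, ψ, A)` such that both `A`
and its GNS adjoint `A†` are real (`*`-preserving) — in particular when `A` is real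
and `ψ` is tracial — the operator norm of `A` on `L²(B, ψ)` equals `d`. -/
theorem norm_eq_degree_of_real_adjoint
    (B : Type*) [NormedRing B] [StarRing B] [CStarRing B] [NormedAlgebra ℂ B]
    [StarModule ℂ B] [FiniteDimensional ℂ B]
    (ψ : B →ₗ[ℂ] ℂ)
    (hψ1 : ψ 1 = 1)
    (hψpos : ∀ x : B, 0 ≤ (ψ (star x * x)).re ∧ (ψ (star x * x)).im = 0)
    (hψfaith : ∀ x : B, ψ (star x * x) = 0 → x = 0)
    (δ : ℝ) (hδ : 0 < δ)
    (mdag : B →ₗ[ℂ] TensorProduct ℂ B B)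
    (hmdag : ∀ a b c : B, pairQ B ψ (star b) (star c) (mdag a) = ψ (star (b * c) * a))
    (hδform : LinearMap.mul' ℂ B ∘ₗ mdag = ((δ : ℂ) ^ 2) • LinearMap.id)
    (A Adag : B →ₗ[ℂ] B)
    (hSchur : ((δ : ℂ) ^ 2) • A = LinearMap.mul' ℂ B ∘ₗ TensorProduct.map A A ∘ₗ mdag)
    (hAdag : ∀ x y : B, ψ (star (A x) * y) = ψ (star x * Adag y))
    (hreal : ∀ x : B, A (star x) = star (A x))
    (hrealdag : ∀ x : B, Adag (star x) = star (Adag x))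
    (d : ℝ)
    (hreg1 : A 1 = (d : ℂ) • 1)
    (hreg2 : Adag 1 = (d : ℂ) • 1) :
    (∀ x : B, (ψ (star (A x) * A x)).re ≤ d ^ 2 * (ψ (star x * x)).re) ∧
      (∀ c : ℝ, 0 ≤ c →
        (∀ x : B, (ψ (star (A x) * A x)).re ≤ c ^ 2 * (ψ (star x * x)).re) → d ≤ c) := by
  have hs := psi_star B ψ (fun x => (hψpos x).2)
  obtain ⟨n, e, he⟩ := exists_basis B ψ hψpos hψfaith
  have hf : ∀ x y : B, ((δ : ℂ) ^ 2) • A (star y * x) =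
      ∑ i, star (A (star (e i) * y)) * A (star (e i) * x) := by
    intro x y
    have := LinearMap.congr_fun hSchur (star y * x)
    simp only [LinearMap.smul_apply, LinearMap.comp_apply,
      mdag_formula B ψ hs e he mdag hmdag, map_sum, TensorProduct.map_tmul,
      LinearMap.mul'_apply] at this
    rw [this]
    refine Finset.sum_congr rfl fun i _ => ?_
    rw [← hreal]
    simp
  have hN : ∀ x : B, ψ (A (star x * x)) = d * ψ (star x * x) := by
    intro x
    have := hAdag (star x * x) 1
    rw [hreg2, ← hreal] at this
    simpa using this
  have hpos : ∀ (x : B) (t : ℝ), 0 ≤ d * (ψ (star x * x)).re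
      - 2 * t * (ψ (star (A x) * A x)).re + t ^ 2 * d * (ψ (star (A x) * A x)).re := by
    intro x t
    have h1 := hf x x
    have h2 := hf x 1
    have h3 := hf 1 x
    have h4 := hf 1 1
    simp only [star_one, one_mul, mul_one, hreg1, hreal] at h1 h2 h3 h4
    set z : B := (t : ℂ) • A x with hz
    have hsum : ∑ i, star (A (star (e i) * x) - star (A (e i)) * z) *
        (A (star (e i) * x) - star (A (e i)) * z) =
        ((δ : ℂ) ^ 2) • (A (star x * x) - star (A x) * z - star z * A x
          + (d : ℂ) • (star z * z)) := by
      have h5 : ((δ : ℂ) ^ 2) • (d : ℂ) • (star z * z) =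
          star z * (((δ : ℂ) ^ 2) • (d : ℂ) • (1 : B)) * z := by simp
      rw [smul_add, smul_sub, smul_sub, h5, h4, h1, ← smul_mul_assoc, h3,
        ← mul_smul_comm, h2]
      simp only [Finset.sum_mul, Finset.mul_sum, ← Finset.sum_sub_distrib,
        ← Finset.sum_add_distrib]
      refine Finset.sum_congr rfl fun i _ => ?_
      simp only [star_sub, star_mul, star_star]
      noncomm_ring
    have hge : 0 ≤ (ψ (∑ i, star (A (star (e i) * x) - star (A (e i)) * z) *
        (A (star (e i) * x) - star (A (e i)) * z))).re := by
      rw [map_sum, Complex.re_sum]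
      exact Finset.sum_nonneg fun i _ => (hψpos _).1
    rw [hsum, hz] at hge
    have hc : ψ (((δ : ℂ) ^ 2) • (A (star x * x) - star (A x) * ((t : ℂ) • A x)
        - star ((t : ℂ) • A x) * A x
        + (d : ℂ) • (star ((t : ℂ) • A x) * ((t : ℂ) • A x)))) =
        ((δ ^ 2 : ℝ) : ℂ) * ((d : ℂ) * ψ (star x * x)
          - ((2 * t : ℝ) : ℂ) * ψ (star (A x) * A x)
          + ((t ^ 2 * d : ℝ) : ℂ) * ψ (star (A x) * A x)) := by
      simp [star_smul, hN]
      ring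
    rw [hc, Complex.re_ofReal_mul, Complex.add_re, Complex.sub_re, Complex.re_ofReal_mul,
      Complex.re_ofReal_mul, Complex.re_ofReal_mul] at hge
    exact nonneg_of_mul_nonneg_right hge (by positivity)
  have hd : 0 ≤ d := by simpa [hψ1] using hpos 1 0
  refine ⟨fun x => ?_, fun c hc h => ?_⟩
  · rcases hd.eq_or_lt with h0 | h0
    · have := hpos x 1
      rw [← h0] at this ⊢
      linarith
    · have := hpos x d⁻¹
      have h1 := mul_nonneg hd this
      have h2 : d * (d * (ψ (star x * x)).re - 2 * d⁻¹ * (ψ (star (A x) * A x)).re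
          + d⁻¹ ^ 2 * d * (ψ (star (A x) * A x)).re) =
          d ^ 2 * (ψ (star x * x)).re - (ψ (star (A x) * A x)).re := by
        field_simp
        ring
      linarith
  · have := h 1
    simp [hreg1, hψ1, star_smul] at this
    exact abs_le_of_sq_le_sq' (by nlinarith) hc |>.2
end

section
/- Let (B, τ, A) be a d-regular undirected tracial quantum graph and let x ∈ ker(d·id − A) be self-adjoint. Then the C*-algebra generated by x is contained in ker(d·id − A); equivalently, all spectral projections of x are eigenvectors of A with eigenvalue d. -/
open TensorProduct

theorem exists_onb_aux (V : Type*) [AddCommGroup V] [Module ℂ V] [FiniteDimensional ℂ V]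
    (c : InnerProductSpace.Core ℂ V) :
    ∃ (n : ℕ) (e : Fin n → V), ∀ v : V, v = ∑ i, c.inner (e i) v • e i := by
  let : NormedAddCommGroup V := c.toNormedAddCommGroup
  let : InnerProductSpace ℂ V := InnerProductSpace.ofCore c.toCore
  let b := stdOrthonormalBasis ℂ V
  exact ⟨_, fun i => b i, fun v => (b.sum_repr' v).symm⟩

theorem tau_star_aux {B : Type*} [Ring B] [StarRing B] [Algebra ℂ B] [StarModule ℂ B]
    (τ : B →ₗ[ℂ] ℂ) (hτ1 : τ 1 = 1)
    (hτpos : ∀ x : B, 0 ≤ (τ (star x * x)).re ∧ (τ (star x * x)).im = 0) (y : B) :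
    τ (star y) = star (τ y) := by
  have h0 := (hτpos y).2
  have h1 := (hτpos (y + 1)).2
  have h2 := (hτpos (y + Complex.I • (1 : B))).2
  have e1 : star (y + 1) * (y + 1) = star y * y + star y + y + 1 := by
    simp only [star_add, star_one]; noncomm_ring
  have e2 : star (y + Complex.I • (1 : B)) * (y + Complex.I • (1 : B))
      = star y * y + Complex.I • star y - Complex.I • y + 1 := by
    simp only [star_add, star_smul, star_one, add_mul, mul_add, smul_mul_assoc, mul_smul_comm,
      one_mul, mul_one]
    have hI : (star Complex.I : ℂ) = -Complex.I := by simp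
    have hII : Complex.I • Complex.I • (1 : B) = -1 := by
      rw [smul_smul, Complex.I_mul_I, neg_smul, one_smul]
    simp only [hI, neg_smul, smul_add, smul_neg, hII]
    abel
  rw [e1] at h1
  rw [e2] at h2
  simp [hτ1, h0] at h1 h2
  apply Complex.ext
  · simp; linarith
  · simp; linarith

/-- For a `d`-regular undirected tracial quantum graph `(B, τ, A)`
and a self-adjoint `x ∈ ker(d·id − A)`, the C*-algebra generated by `x` is contained
in `ker(d·id − A)`. -/
theorem eigenvalue_d_generated_algebra
    (B : Type*) [NormedRing B] [StarRing B] [CStarRing B] [NormedAlgebra ℂ B]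
    [StarModule ℂ B] [FiniteDimensional ℂ B]
    (τ : B →ₗ[ℂ] ℂ)
    (hτ1 : τ 1 = 1)
    (hτpos : ∀ x : B, 0 ≤ (τ (star x * x)).re ∧ (τ (star x * x)).im = 0)
    (hτfaith : ∀ x : B, τ (star x * x) = 0 → x = 0)
    (hτtracial : ∀ a b : B, τ (a * b) = τ (b * a))
    (δ : ℝ) (hδ : 0 < δ)
    (mdag : B →ₗ[ℂ] TensorProduct ℂ B B)
    (hmdag : ∀ a b c : B, pairQ B τ (star b) (star c) (mdag a) = τ (star (b * c) * a))
    (hδform : LinearMap.mul' ℂ B ∘ₗ mdag = ((δ : ℂ) ^ 2) • LinearMap.id)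
    (A : B →ₗ[ℂ] B)
    (hSchur : ((δ : ℂ) ^ 2) • A = LinearMap.mul' ℂ B ∘ₗ TensorProduct.map A A ∘ₗ mdag)
    (hreal : ∀ x : B, A (star x) = star (A x))
    (hsa : ∀ x y : B, τ (star (A x) * y) = τ (star x * A y))
    (d : ℝ)
    (hreg1 : A 1 = (d : ℂ) • 1)
    (hreg2 : ∀ x : B, τ (A x) = (d : ℂ) * τ x)
    (x : B) (hx : A x = (d : ℂ) • x) (hxsa : star x = x) :
    ∀ y ∈ StarAlgebra.adjoin ℂ ({x} : Set B), A y = (d : ℂ) • y := by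
  have hstar := tau_star_aux τ hτ1 hτpos
  let c : InnerProductSpace.Core ℂ B :=
    { inner := fun a b => τ (star a * b)
      conj_inner_symm := by
        intro a b
        have := hstar (star b * a)
        simp only [star_mul, star_star] at this
        exact this.symm
      re_inner_nonneg := fun a => (hτpos a).1
      add_left := by intro a b z; simp [add_mul]
      smul_left := by intro a b r; simp
      definite := hτfaith }
  obtain ⟨n, e, he⟩ := exists_onb_aux B c
  have he : ∀ v : B, v = ∑ i, τ (star (e i) * v) • e i := he
  -- the tensors are determined by the pairing
  have hdet : ∀ t : TensorProduct ℂ B B,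
      t = ∑ i, ∑ j, pairQ B τ (star (e i)) (star (e j)) t • (e i ⊗ₜ[ℂ] e j) := by
    intro t
    induction t using TensorProduct.induction_on with
    | zero => simp
    | add t s ht hs =>
      simp only [map_add, add_smul, Finset.sum_add_distrib]
      rw [← ht, ← hs]
    | tmul u v =>
      conv_lhs => rw [he u, he v]
      simp only [TensorProduct.sum_tmul, TensorProduct.tmul_sum, TensorProduct.smul_tmul_smul]
      rw [Finset.sum_comm]
      simp [pairQ]
  have hm : ∀ a b : B, mdag (a * b) = ∑ i, (a * e i) ⊗ₜ[ℂ] (star (e i) * b) := by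
    intro a b
    have key : ∀ p q : B, pairQ B τ (star p) (star q) (mdag (a * b)) =
        pairQ B τ (star p) (star q) (∑ i, (a * e i) ⊗ₜ[ℂ] (star (e i) * b)) := by
      intro p q
      rw [hmdag, map_sum]
      have h1 : ∀ i, pairQ B τ (star p) (star q) ((a * e i) ⊗ₜ[ℂ] (star (e i) * b))
          = τ (star p * a * (τ (star (e i) * (b * star q)) • e i)) := by
        intro i
        have : τ (star q * (star (e i) * b)) = τ (star (e i) * (b * star q)) := by
          rw [hτtracial, mul_assoc]
        simp [pairQ, this, mul_assoc, mul_comm]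
      rw [Finset.sum_congr rfl (fun i _ => h1 i), ← map_sum, ← Finset.mul_sum, ← he,
        star_mul, mul_assoc, hτtracial]
      simp only [mul_assoc]
    rw [hdet (mdag (a * b)), hdet (∑ i, (a * e i) ⊗ₜ[ℂ] (star (e i) * b))]
    simp only [key]
  have hδ' : ((δ : ℂ) ^ 2) ≠ 0 := by
    exact pow_ne_zero 2 (by exact_mod_cast hδ.ne')
  have hA : ∀ a b : B, ((δ : ℂ) ^ 2) • A (star a * b)
      = ∑ i, star (A (star (e i) * a)) * A (star (e i) * b) := by
    intro a b
    have := LinearMap.congr_fun hSchur (star a * b)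
    simp only [LinearMap.smul_apply, LinearMap.comp_apply, hm, map_sum, TensorProduct.map_tmul,
      LinearMap.mul'_apply] at this
    rw [this]
    refine Finset.sum_congr rfl fun i _ => ?_
    rw [← hreal, star_mul, star_star]
  let w : Fin n → B := fun i => A (star (e i) * x) - A (star (e i) * 1) * x
  have hsum : ∑ i, star (w i) * w i = ((δ : ℂ) ^ 2) • (A (x * x) - (d : ℂ) • (x * x)) := by
    have hxx := hA x x
    have hx1 := hA x 1
    have h1x := hA 1 x
    have h11 := hA 1 1
    simp only [hxsa, star_one, one_mul, mul_one, hx, hreg1] at hxx hx1 h1x h11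
    have : ∀ i, star (w i) * w i = star (A (star (e i) * x)) * A (star (e i) * x)
        - (star (A (star (e i) * x)) * A (star (e i))) * x
        - x * (star (A (star (e i))) * A (star (e i) * x))
        + x * (star (A (star (e i))) * A (star (e i))) * x := by
      intro i
      simp only [w, star_sub, star_mul, hxsa, mul_one]
      noncomm_ring
    simp only [this, Finset.sum_add_distrib, Finset.sum_sub_distrib, ← Finset.sum_mul,
      ← Finset.mul_sum]
    rw [← hxx, ← hx1, ← h1x, ← h11]
    simp only [smul_mul_assoc, mul_smul_comm, mul_one, smul_sub]
    abel
  have hτsum : ∑ i, τ (star (w i) * w i) = 0 := by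
    rw [← map_sum, hsum, map_smul, map_sub, hreg2, map_smul]
    simp
  have hw : ∀ i, w i = 0 := by
    intro i
    apply hτfaith
    have hre : ∑ i, (τ (star (w i) * w i)).re = 0 := by
      rw [← Complex.re_sum, hτsum, Complex.zero_re]
    have := (Finset.sum_eq_zero_iff_of_nonneg (fun i _ => (hτpos (w i)).1)).1 hre i
      (Finset.mem_univ i)
    exact Complex.ext this (hτpos (w i)).2
  have hmulx : ∀ z : B, A (z * x) = A z * x := by
    intro z
    have h1 := hA (star z) x
    have h2 := hA (star z) 1
    rw [star_star] at h1 h2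
    apply smul_right_injective B hδ'
    show ((δ : ℂ) ^ 2) • A (z * x) = ((δ : ℂ) ^ 2) • (A z * x)
    rw [mul_one] at h2
    rw [h1, ← smul_mul_assoc, h2, Finset.sum_mul]
    refine Finset.sum_congr rfl fun i _ => ?_
    rw [sub_eq_zero.1 (hw i), mul_assoc]
  intro y hy
  have hall : ∀ z : B, A (z * y) = A z * y := by
    have hy' : y ∈ Algebra.adjoin ℂ ({x} : Set B) := by
      have h : y ∈ Algebra.adjoin ℂ (({x} : Set B) ∪ star {x}) := hy
      have hs : (star {x} : Set B) = {x} := by rw [Set.star_singleton, hxsa]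
      rwa [hs, Set.union_self] at h
    clear hy
    induction hy' using Algebra.adjoin_induction with
    | mem u hu => rw [Set.mem_singleton_iff.1 hu]; exact hmulx
    | algebraMap r => intro z; simp [Algebra.algebraMap_eq_smul_one]
    | add u v _ _ hu hv => intro z; rw [mul_add, map_add, hu, hv, mul_add]
    | mul u v _ _ hu hv => intro z; rw [← mul_assoc, hv, hu, mul_assoc]
  have := hall 1
  rw [one_mul, hreg1, smul_mul_assoc, one_mul] at this
  exact this
end

section
/- Let (B, τ, A) be a d-regular undirected tracial quantum graph. Then the following are equivalent: (1) there is no injective unital *-homomorphism f : ℂ² → B such that ⟨f(e₁)| A f(e₂)⟩ = 0 = ⟨f(e₂)| A f(e₁)⟩ (i.e. G is connected); (2) the eigenvalue d of A on L²(B, τ) is simple, i.e. dim ker(d·id − A) = 1. -/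
open TensorProduct

theorem tau_star {B : Type*} [Ring B] [StarRing B] [Algebra ℂ B] [StarModule ℂ B]
    (τ : B →ₗ[ℂ] ℂ)
    (hτpos : ∀ x : B, 0 ≤ (τ (star x * x)).re ∧ (τ (star x * x)).im = 0) (w : B) :
    τ (star w) = star (τ w) := by
  have h1 := (hτpos (1 + w)).2
  have h2 := (hτpos (1 + Complex.I • w)).2
  have h0 := (hτpos 1).2
  have h3 := (hτpos w).2
  have h4 := (hτpos (Complex.I • w)).2
  simp only [star_add, star_one, add_mul, mul_add, one_mul, mul_one, map_add, Complex.add_im,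
    star_smul] at h1 h2 h0 h4
  rw [h4] at h2
  simp at h0 h1 h2
  rw [h0] at h1 h2
  rw [h3] at h1
  apply Complex.ext
  · simp; linarith
  · simp; linarith

theorem exists_onb {B : Type*} [Ring B] [StarRing B] [Algebra ℂ B] [StarModule ℂ B]
    [FiniteDimensional ℂ B] (τ : B →ₗ[ℂ] ℂ)
    (hτpos : ∀ x : B, 0 ≤ (τ (star x * x)).re ∧ (τ (star x * x)).im = 0)
    (hτfaith : ∀ x : B, τ (star x * x) = 0 → x = 0) :
    ∃ (n : ℕ) (u : Fin n → B), ∀ y, ∑ i, τ (star (u i) * y) • u i = y := by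
  let core : InnerProductSpace.Core ℂ B :=
    { inner := fun x y => τ (star x * y)
      conj_inner_symm := fun x y => by
        have := tau_star τ hτpos (star y * x)
        simp only [star_mul, star_star] at this
        rw [this]; rfl
      re_inner_nonneg := fun x => (hτpos x).1
      add_left := fun x y z => by simp [add_mul]
      smul_left := fun x y r => by simp
      definite := hτfaith }
  let _ : NormedAddCommGroup B := core.toNormedAddCommGroup
  let _ : InnerProductSpace ℂ B := InnerProductSpace.ofCore core.toCore
  let b := stdOrthonormalBasis ℂ B
  exact ⟨_, b, fun y => b.sum_repr' y⟩

theorem A_sq {B : Type*} [Ring B] [StarRing B] [Algebra ℂ B] [StarModule ℂ B]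
    [FiniteDimensional ℂ B] (τ : B →ₗ[ℂ] ℂ)
    (hτpos : ∀ x : B, 0 ≤ (τ (star x * x)).re ∧ (τ (star x * x)).im = 0)
    (hτfaith : ∀ x : B, τ (star x * x) = 0 → x = 0)
    (hτtracial : ∀ a b : B, τ (a * b) = τ (b * a))
    (δ : ℝ)
    (mdag : B →ₗ[ℂ] TensorProduct ℂ B B)
    (hmdag : ∀ a b c : B, pairQ B τ (star b) (star c) (mdag a) = τ (star (b * c) * a))
    (A : B →ₗ[ℂ] B)
    (hSchur : ((δ : ℂ) ^ 2) • A = LinearMap.mul' ℂ B ∘ₗ TensorProduct.map A A ∘ₗ mdag)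
    (hreal : ∀ x : B, A (star x) = star (A x)) :
    ∃ n : ℕ, ∀ y : B, ∃ c : Fin n → B, ((δ : ℂ) ^ 2) • A (star y * y) = ∑ i, star (c i) * c i := by
  obtain ⟨n, u, hu⟩ := exists_onb τ hτpos hτfaith
  refine ⟨n, fun y => ⟨fun i => A (star (u i) * y), ?_⟩⟩
  have hrec : ∀ t : TensorProduct ℂ B B,
      ∑ i, ∑ j, pairQ B τ (star (u i)) (star (u j)) t • (u i ⊗ₜ[ℂ] u j) = t := by
    intro t
    induction t with
    | zero => simp
    | add x y hx hy =>
      simp only [map_add, add_smul, Finset.sum_add_distrib, hx, hy]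
    | tmul x y =>
      conv_rhs => rw [← hu x, ← hu y]
      simp only [TensorProduct.sum_tmul, TensorProduct.tmul_sum, TensorProduct.smul_tmul_smul]
      simp only [pairQ, TensorProduct.lift.tmul, LinearMap.compl₁₂_apply, LinearMap.comp_apply,
        LinearMap.mulLeft_apply, LinearMap.mul_apply']
      exact Finset.sum_comm
  have key : mdag (star y * y) = ∑ i, (star y * u i) ⊗ₜ[ℂ] (star (u i) * y) := by
    rw [← hrec (mdag (star y * y)), ← hrec (∑ i, (star y * u i) ⊗ₜ[ℂ] (star (u i) * y))]
    refine Finset.sum_congr rfl fun i _ => Finset.sum_congr rfl fun j _ => ?_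
    congr 1
    rw [hmdag]
    generalize u i = b
    generalize u j = c
    have e := congrArg (fun z => τ (star b * star y * z)) (hu (y * star c))
    simp only [Finset.mul_sum, map_sum, mul_smul_comm, map_smul, smul_eq_mul] at e
    simp only [map_sum, pairQ, TensorProduct.lift.tmul, LinearMap.compl₁₂_apply, LinearMap.comp_apply,
      LinearMap.mulLeft_apply, LinearMap.mul_apply']
    rw [star_mul, hτtracial, hτtracial (star y * y) ]
    have e2 : τ (star c * star b * (star y * y)) = τ (star b * star y * (y * star c)) := by
      rw [mul_assoc, hτtracial]; simp only [mul_assoc]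
    rw [e2, ← e]
    refine Finset.sum_congr rfl fun k _ => ?_
    rw [hτtracial (star c), mul_comm]
    simp only [mul_assoc]
  have := LinearMap.congr_fun hSchur (star y * y)
  simp only [LinearMap.smul_apply, LinearMap.comp_apply, key, map_sum, TensorProduct.map_tmul,
    LinearMap.mul'_apply] at this
  rw [this]
  refine Finset.sum_congr rfl fun i _ => ?_
  rw [← hreal]; simp

theorem finspec {B : Type*} [CStarAlgebra B] [FiniteDimensional ℂ B] (x : B) :
    (spectrum ℝ x).Finite := by
  have h : (spectrum ℂ x).Finite := by
    cases subsingleton_or_nontrivial B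
    · simp
    have hint : IsIntegral ℂ x := Algebra.IsIntegral.isIntegral x
    refine ((minpoly ℂ x).rootSet_finite ℂ).subset fun k hk => ?_
    have := spectrum.subset_polynomial_aeval x (minpoly ℂ x) ⟨k, hk, rfl⟩
    rw [minpoly.aeval, spectrum.zero_eq] at this
    rw [Polynomial.mem_rootSet]
    exact ⟨minpoly.ne_zero hint, by simpa using this⟩
  rw [← spectrum.preimage_algebraMap ℂ]
  exact h.preimage (algebraMap ℝ ℂ).injective.injOn

theorem exists_proj {B : Type*} [CStarAlgebra B] [FiniteDimensional ℂ B] [Nontrivial B] (x : B)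
    (hx : IsSelfAdjoint x) (hns : ∀ c : ℂ, x ≠ c • 1) :
    ∃ (p z : B) (l C : ℝ), star p = p ∧ p * p = p ∧ p ≠ 0 ∧ 1 - p ≠ 0 ∧
      (C : ℂ) • ((l : ℂ) • 1 - x) - (1 - p) = star z * z ∧ p * ((l : ℂ) • 1 - x) = 0 := by
  have hf := finspec x
  have hne : (spectrum ℝ x).Nonempty := ContinuousFunctionalCalculus.spectrum_nonempty x hx
  have hc : ∀ f : ℝ → ℝ, ContinuousOn f (spectrum ℝ x) := fun f => hf.continuousOn f
  obtain ⟨l, hl, hmax⟩ : ∃ l ∈ spectrum ℝ x, ∀ t ∈ spectrum ℝ x, t ≤ l :=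
    Set.exists_max_image _ id hf hne
  obtain ⟨C, hC⟩ := (hf.image (fun t => (l - t)⁻¹)).bddAbove
  have hC' : ∀ t ∈ spectrum ℝ x, t ≠ l → 1 ≤ C * (l - t) := fun t ht htl => by
    have h1 : 0 < l - t := sub_pos.2 (lt_of_le_of_ne (hmax t ht) htl)
    have h2 : (l - t)⁻¹ ≤ C := hC ⟨t, ht, rfl⟩
    calc 1 = (l - t)⁻¹ * (l - t) := (inv_mul_cancel₀ h1.ne').symm
      _ ≤ _ := by gcongr
  classical
  let e : ℝ → ℝ := fun t => if t = l then 1 else 0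
  let g : ℝ → ℝ := fun t => C * (l - t) - (1 - e t)
  have hg : ∀ t ∈ spectrum ℝ x, 0 ≤ g t := fun t ht => by
    by_cases h : t = l
    · simp [g, e, h]
    · have := hC' t ht h
      simp only [g, e, h, if_false]; linarith
  have hone : cfc (fun _ : ℝ => (1 : ℝ)) x = 1 := cfc_const_one ℝ x
  have hy : cfc (fun t : ℝ => l - t) x = (l : ℂ) • 1 - x := by
    rw [cfc_sub (R := ℝ) (fun _ => l) (fun t => t) x (hc _) (hc _), cfc_const l x, cfc_id' ℝ x,
      Algebra.algebraMap_eq_smul_one]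
    simp
  refine ⟨cfc e x, cfc (fun t => Real.sqrt (g t)) x, l, C, ?_, ?_, ?_, ?_, ?_, ?_⟩
  · exact cfc_predicate e x
  · rw [← cfc_mul e e x (hc _) (hc _)]
    congr 1; ext t; simp [e]
  · intro h
    rw [← cfc_zero ℝ x, cfc_eq_cfc_iff_eqOn hx (hc _) (hc _)] at h
    simpa [e] using h hl
  · intro h
    rw [sub_eq_zero, ← hone, cfc_eq_cfc_iff_eqOn hx (hc _) (hc _)] at h
    apply hns l
    have h2 : cfc (fun t : ℝ => l - t) x = cfc (fun _ : ℝ => (0:ℝ)) x := by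
      apply cfc_congr
      intro t ht
      have := h ht
      by_cases htl : t = l
      · simp [htl]
      · simp [e, htl] at this
    rw [hy, cfc_const_zero, sub_eq_zero] at h2
    exact h2.symm
  · have hz : star (cfc (fun t => Real.sqrt (g t)) x) = cfc (fun t => Real.sqrt (g t)) x :=
      cfc_predicate (R := ℝ) (p := IsSelfAdjoint) _ x
    rw [hz, ← cfc_mul _ _ x (hc _) (hc _)]
    rw [cfc_congr (g := g) (fun t ht => Real.mul_self_sqrt (hg t ht))]
    simp only [g]
    rw [cfc_sub (R := ℝ) (fun t => C * (l - t)) (fun t => 1 - e t) x (hc _) (hc _),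
      cfc_sub (R := ℝ) (fun _ => 1) e x (hc _) (hc _), hone,
      cfc_const_mul C (fun t => l - t) x (hc _), hy]
    simp
  · rw [← hy, ← cfc_mul e _ x (hc _) (hc _)]
    rw [← cfc_const_zero ℝ x]
    congr 1; ext t
    by_cases h : t = l <;> simp [e, h]

/-- the star-homomorphism attached to a projection -/
noncomputable def projHom {B : Type*} [Ring B] [StarRing B] [Algebra ℂ B] [StarModule ℂ B]
    (p : B) (hs : star p = p) (hp : p * p = p) : (Fin 2 → ℂ) →⋆ₐ[ℂ] B where
  toFun v := v 0 • p + v 1 • (1 - p)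
  map_one' := by simp
  map_zero' := by simp
  map_add' v w := by simp only [Pi.add_apply, add_smul]; abel
  map_mul' v w := by
    have h1 : p * (1 - p) = 0 := by rw [mul_sub, hp, mul_one, sub_self]
    have h2 : (1 - p) * p = 0 := by rw [sub_mul, hp, one_mul, sub_self]
    have h3 : (1 - p) * (1 - p) = 1 - p := by rw [mul_sub, h2, mul_one, sub_zero]
    simp only [add_mul, mul_add, smul_mul_smul_comm, h1, h2, h3, hp, Pi.mul_apply]
    simp
  commutes' r := by
    simp [Algebra.algebraMap_eq_smul_one, ← smul_add]
  map_star' v := by simp [hs]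

/-- A `d`-regular undirected tracial quantum graph `(B, τ, A)` is
connected — i.e. there is no injective unital `*`-homomorphism `f : ℂ² → B` with
`⟨f e₁, A f e₂⟩ = 0 = ⟨f e₂, A f e₁⟩` (no surjective graph homomorphism onto the
trivial graph `T₂`) — if and only if the eigenvalue `d` of `A` on `L²(B, τ)` is
simple, i.e. `dim ker(d·id − A) = 1`. -/
theorem connected_iff_simple_eigenvalue
    (B : Type*) [NormedRing B] [StarRing B] [CStarRing B] [NormedAlgebra ℂ B]
    [StarModule ℂ B] [FiniteDimensional ℂ B]
    (τ : B →ₗ[ℂ] ℂ)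
    (hτ1 : τ 1 = 1)
    (hτpos : ∀ x : B, 0 ≤ (τ (star x * x)).re ∧ (τ (star x * x)).im = 0)
    (hτfaith : ∀ x : B, τ (star x * x) = 0 → x = 0)
    (hτtracial : ∀ a b : B, τ (a * b) = τ (b * a))
    (δ : ℝ) (hδ : 0 < δ)
    (mdag : B →ₗ[ℂ] TensorProduct ℂ B B)
    (hmdag : ∀ a b c : B, pairQ B τ (star b) (star c) (mdag a) = τ (star (b * c) * a))
    (hδform : LinearMap.mul' ℂ B ∘ₗ mdag = ((δ : ℂ) ^ 2) • LinearMap.id)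
    (A : B →ₗ[ℂ] B)
    (hSchur : ((δ : ℂ) ^ 2) • A = LinearMap.mul' ℂ B ∘ₗ TensorProduct.map A A ∘ₗ mdag)
    (hreal : ∀ x : B, A (star x) = star (A x))
    (hsa : ∀ x y : B, τ (star (A x) * y) = τ (star x * A y))
    (d : ℝ)
    (hreg1 : A 1 = (d : ℂ) • 1)
    (hreg2 : ∀ x : B, τ (A x) = (d : ℂ) * τ x) :
    (¬ ∃ f : (Fin 2 → ℂ) →⋆ₐ[ℂ] B, Function.Injective f ∧
        τ (star (f (Pi.single 0 1)) * A (f (Pi.single 1 1))) = 0 ∧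
        τ (star (f (Pi.single 1 1)) * A (f (Pi.single 0 1))) = 0) ↔
      Module.finrank ℂ
        (LinearMap.ker ((d : ℂ) • (LinearMap.id : B →ₗ[ℂ] B) - A)) = 1 := by
  obtain ⟨n, hA⟩ := A_sq τ hτpos hτfaith hτtracial δ mdag hmdag A hSchur hreal
  have hδ2 : ((δ : ℂ) ^ 2) ≠ 0 := by
    have : (δ : ℂ) ≠ 0 := by exact_mod_cast hδ.ne'
    exact pow_ne_zero 2 this
  have h10 : (1 : B) ≠ 0 := fun h => by rw [h] at hτ1; simp at hτ1
  haveI : Nontrivial B := ⟨1, 0, h10⟩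
  have hmem : ∀ x : B, x ∈ LinearMap.ker ((d : ℂ) • (LinearMap.id : B →ₗ[ℂ] B) - A) ↔
      A x = (d : ℂ) • x := fun x => by
    rw [LinearMap.mem_ker, LinearMap.sub_apply, sub_eq_zero, eq_comm]; rfl
  -- expansion of `τ (p * A (star z * z))`
  have hexp : ∀ p z : B, star p = p → p * p = p → ∃ c : Fin n → B,
      ((δ : ℂ) ^ 2) • A (star z * z) = ∑ i, star (c i) * c i ∧
      ((δ : ℂ) ^ 2) * τ (p * A (star z * z)) = ∑ i, τ (star (c i * p) * (c i * p)) := by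
    intro p z hs hp
    obtain ⟨c, hc⟩ := hA z
    refine ⟨c, hc, ?_⟩
    rw [← smul_eq_mul, ← map_smul, ← mul_smul_comm, hc, Finset.mul_sum, map_sum]
    refine Finset.sum_congr rfl fun i _ => ?_
    rw [star_mul, hs]
    conv_lhs => rw [← hp, mul_assoc, hτtracial]
    simp only [mul_assoc]
  have hnn : ∀ p z : B, star p = p → p * p = p → 0 ≤ (τ (p * A (star z * z))).re := by
    intro p z hs hp
    obtain ⟨c, -, hc⟩ := hexp p z hs hp
    have h1 := congrArg Complex.re hc
    rw [← Complex.ofReal_pow, Complex.re_ofReal_mul, Complex.re_sum] at h1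
    have h2 : 0 ≤ ∑ i, (τ (star (c i * p) * (c i * p))).re :=
      Finset.sum_nonneg fun i _ => (hτpos _).1
    rw [← h1] at h2
    exact nonneg_of_mul_nonneg_right h2 (by positivity)
  have hvan : ∀ p q : B, star p = p → p * p = p → star q = q → q * q = q →
      τ (p * A q) = 0 → A q * p = 0 := by
    intro p q hs hp hqs hq h0
    obtain ⟨c, hc1, hc⟩ := hexp p q hs hp
    rw [hqs, hq] at hc1 hc
    rw [h0, mul_zero] at hc
    have h1 := congrArg Complex.re hc
    rw [Complex.re_sum, Complex.zero_re] at h1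
    have h2 := (Finset.sum_eq_zero_iff_of_nonneg fun i _ => (hτpos (c i * p)).1).1 h1.symm
    have h3 : ∀ i, c i * p = 0 := fun i =>
      hτfaith _ (Complex.ext (h2 i (Finset.mem_univ i)) (hτpos _).2)
    have h4 : ((δ : ℂ) ^ 2) • (A q * p) = 0 := by
      rw [← smul_mul_assoc, hc1, Finset.sum_mul]
      exact Finset.sum_eq_zero fun i _ => by rw [mul_assoc, h3, mul_zero]
    exact (smul_eq_zero.1 h4).resolve_left hδ2
  constructor
  · intro hcon
    by_contra hfin
    apply hcon
    -- a nonscalar element of the eigenspace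
    obtain ⟨w, hw, hwns⟩ : ∃ w : B, A w = (d : ℂ) • w ∧ ∀ c : ℂ, w ≠ c • 1 := by
      by_contra! hno
      apply hfin
      refine finrank_eq_one_iff'.2 ⟨⟨1, (hmem 1).2 hreg1⟩, fun h => h10 (congrArg Subtype.val h),
        fun w => ?_⟩
      obtain ⟨c, hc⟩ := hno w.1 ((hmem _).1 w.2)
      exact ⟨c, Subtype.ext hc.symm⟩
    have hws : A (star w) = (d : ℂ) • star w := by rw [hreal, hw, star_smul]; simp
    obtain ⟨x, hxA, hx, hns⟩ : ∃ x : B, A x = (d : ℂ) • x ∧ IsSelfAdjoint x ∧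
        ∀ c : ℂ, x ≠ c • 1 := by
      by_contra! hno
      obtain ⟨a, ha⟩ := hno (w + star w) (by rw [map_add, hw, hws, smul_add])
        (by simp [IsSelfAdjoint, add_comm])
      obtain ⟨b, hb⟩ := hno (Complex.I • (w - star w))
        (by rw [map_smul, map_sub, hw, hws, ← smul_sub, smul_comm])
        (by simp [IsSelfAdjoint, ← smul_neg])
      apply hwns ((a - Complex.I * b) / 2)
      have h1 : w - star w = (- Complex.I * b) • (1 : B) := by
        rw [mul_smul, ← hb, smul_smul]; simp
      have h2 : (2 : ℂ) • w = (a - Complex.I * b) • (1 : B) := by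
        rw [sub_eq_add_neg, ← neg_mul, add_smul, ← h1, ← ha, two_smul]; abel
      rw [div_eq_inv_mul, mul_smul, ← h2, smul_smul]; simp
    letI : CompleteSpace B := FiniteDimensional.complete ℂ B
    letI : CStarAlgebra B := {}
    obtain ⟨p, z, l, C, hs, hp, hp0, hp1, hz, hpy⟩ := exists_proj x hx hns
    have hqs : star (1 - p) = 1 - p := by simp [hs]
    have hpq : p * (1 - p) = 0 := by rw [mul_sub, hp, mul_one, sub_self]
    have hqp : (1 - p) * p = 0 := by rw [sub_mul, hp, one_mul, sub_self]
    have hq : (1 - p) * (1 - p) = 1 - p := by rw [mul_sub, hqp, mul_one, sub_zero]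
    have hAy : A ((l : ℂ) • 1 - x) = (d : ℂ) • ((l : ℂ) • 1 - x) := by
      rw [map_sub, map_smul, hreg1, hxA, smul_sub, smul_comm]
    have h1 := hnn p z hs hp
    rw [← hz, map_sub, map_smul, hAy, mul_sub, mul_smul_comm, mul_smul_comm, hpy] at h1
    have h2 := hnn p (1 - p) hs hp
    rw [hqs, hq] at h2
    have hre : (τ (p * A (1 - p))).re = 0 := by
      simp at h1 h2 ⊢
      linarith
    have him : (τ (p * A (1 - p))).im = 0 := by
      have h3 := tau_star τ hτpos (p * A (1 - p))
      rw [star_mul, ← hreal, hqs, hs, hτtracial] at h3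
      have := congrArg Complex.im h3
      simp only [Complex.star_def, Complex.conj_im] at this
      linarith
    have h0 : τ (p * A (1 - p)) = 0 := Complex.ext hre him
    have h0' : τ ((1 - p) * A p) = 0 := by
      have := hsa (1 - p) p
      rw [hqs, ← hreal, hqs, hτtracial, h0] at this
      exact this.symm
    refine ⟨projHom p hs hp, ?_, ?_, ?_⟩
    · rw [injective_iff_map_eq_zero]
      intro v hv
      have hv : v 0 • p + v 1 • (1 - p) = 0 := hv
      have e0 := congrArg (p * ·) hv
      have e1 := congrArg ((1 - p) * ·) hv
      simp only [mul_add, mul_smul_comm, hp, hpq, hqp, hq, smul_zero, add_zero, zero_add,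
        mul_zero, smul_eq_zero, hp0, hp1, or_false] at e0 e1
      ext i; fin_cases i
      · exact e0
      · exact e1
    · simpa [projHom, hs] using h0
    · simpa [projHom, hs] using h0'
  · rintro hfin ⟨f, hinj, h01, h10'⟩
    set p := f (Pi.single 0 1) with hpdef
    set q := f (Pi.single 1 1) with hqdef
    have hs : star p = p := by
      rw [hpdef, ← map_star]; congr 1; ext i; fin_cases i <;> simp
    have hqs : star q = q := by
      rw [hqdef, ← map_star]; congr 1; ext i; fin_cases i <;> simp
    have hp : p * p = p := by
      rw [hpdef, ← map_mul]; congr 1; ext i; fin_cases i <;> simp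
    have hq : q * q = q := by
      rw [hqdef, ← map_mul]; congr 1; ext i; fin_cases i <;> simp
    have hpq1 : p + q = 1 := by
      rw [hpdef, hqdef, ← map_add, ← map_one f]; congr 1; ext i; fin_cases i <;> simp
    rw [hs] at h01
    rw [hqs] at h10'
    have hv1 := hvan p q hs hp hqs hq h01
    have hv2 := hvan q p hqs hq hs hp h10'
    have hAp : A p = (d : ℂ) • p := by
      have e1 : A p = A p * p := by
        conv_lhs => rw [← mul_one (A p), ← hpq1, mul_add, hv2, add_zero]
      have e2 : A p + A q = (d : ℂ) • 1 := by rw [← map_add, hpq1, hreg1]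
      rw [e1, eq_sub_of_add_eq e2, sub_mul, hv1, sub_zero, smul_mul_assoc, one_mul]
    have h1ne : (⟨1, (hmem 1).2 hreg1⟩ :
        LinearMap.ker ((d : ℂ) • (LinearMap.id : B →ₗ[ℂ] B) - A)) ≠ 0 :=
      fun h => h10 (congrArg Subtype.val h)
    obtain ⟨c, hc⟩ := exists_smul_eq_of_finrank_eq_one hfin h1ne ⟨p, (hmem p).2 hAp⟩
    have hc : c • (1 : B) = p := congrArg Subtype.val hc
    have hc2 : f (c • 1) = f (Pi.single 0 1) := by rw [map_smul, map_one]; exact hc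
    have hc3 := hinj hc2
    have a0 := congrFun hc3 0
    have a1 := congrFun hc3 1
    simp at a0 a1
    rw [a0] at a1
    exact one_ne_zero a1
end

section
/- Let (B, τ, A) be a connected d-regular undirected tracial quantum graph. Then the following are equivalent: (1) there is an injective unital *-homomorphism f : ℂ² → B with ⟨f(eᵢ)| A f(eᵢ)⟩ = 0 for i = 1,2 (i.e. G is bipartite, admitting a surjective graph homomorphism to K₂); (2) −d ∈ Spec(A) (with the convention that if d = 0 we additionally require dim B ≥ 2). Moreover, in the bipartite case the projections x₁ = f(e₁), x₂ = f(e₂) satisfy τ(x₁) = τ(x₂) = 1/2, A x₁ = d x₂, A x₂ = d x₁, and A(x₁ − x₂) = −d(x₁ − x₂). -/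
open TensorProduct

/-- In a finite-dimensional algebra, spectra are finite. -/
lemma qg_spectrum_finite (K B : Type*) [Field K] [Ring B] [Algebra K B] [FiniteDimensional K B]
    (x : B) : (spectrum K x).Finite := by
  rcases subsingleton_or_nontrivial B with h | h
  · rw [spectrum.of_subsingleton]; exact Set.finite_empty
  have hx : IsIntegral K x := Algebra.IsIntegral.isIntegral x
  refine ((minpoly K x).rootSet_finite K).subset ?_
  intro r hr
  have h1 := spectrum.subset_polynomial_aeval x (minpoly K x) ⟨r, hr, rfl⟩
  rw [minpoly.aeval, spectrum.zero_eq] at h1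
  rw [Polynomial.mem_rootSet]
  exact ⟨minpoly.ne_zero hx, by simpa [Polynomial.coe_aeval_eq_eval] using h1⟩

/-- Positive spectral projection of a self-adjoint element. -/
lemma qg_proj_aux (C : Type*) [CStarAlgebra C] [FiniteDimensional ℂ C] (x : C)
    (hx : IsSelfAdjoint x) :
    ∃ e p q : C, star e = e ∧ e * e = e ∧ e * x = x * e ∧ e * x = star p * p ∧
      (e - 1) * x = star q * q := by
  have : FiniteDimensional ℝ C := FiniteDimensional.complexToReal C
  have hfin := qg_spectrum_finite ℝ C x
  have hc : ∀ g : ℝ → ℝ, ContinuousOn g (spectrum ℝ x) := fun g => hfin.continuousOn g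
  let i : ℝ → ℝ := fun t => if 0 < t then 1 else 0
  let s : ℝ → ℝ := fun t => if 0 < t then √t else 0
  let u : ℝ → ℝ := fun t => if 0 < t then 0 else √(-t)
  have hid : cfc (fun t : ℝ => t) x = x := cfc_id' ℝ x hx
  have hst : ∀ g : ℝ → ℝ, star (cfc g x) = cfc g x := fun g => (cfc_predicate g x)
  have hii : cfc i x * x = cfc (fun t => i t * t) x := by
    rw [cfc_mul i (fun t => t) x (hc _) (hc _), hid]
  refine ⟨cfc i x, cfc s x, cfc u x, hst i, ?_, ?_, ?_, ?_⟩
  · rw [← cfc_mul i i x (hc _) (hc _)]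
    congr 1; ext t; simp only [i]; split_ifs <;> simp
  · rw [hii]
    have : x * cfc i x = cfc (fun t => t * i t) x := by
      rw [cfc_mul (fun t => t) i x (hc _) (hc _), hid]
    rw [this]; congr 1; ext t; ring
  · rw [hii, hst, ← cfc_mul s s x (hc _) (hc _)]
    congr 1; ext t; simp only [i, s]; split_ifs with h
    · rw [Real.mul_self_sqrt h.le, one_mul]
    · simp
  · rw [sub_mul, one_mul, hii, hst, ← cfc_mul u u x (hc _) (hc _)]
    nth_rewrite 2 [← hid]
    rw [← cfc_sub (fun t => i t * t) (fun t => t) x (hc _) (hc _)]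
    congr 1; ext t; simp only [i, u]; split_ifs with h
    · simp
    · rw [Real.mul_self_sqrt (by linarith)]; ring

lemma qg_proj (B : Type*) [NormedRing B] [StarRing B] [CStarRing B] [NormedAlgebra ℂ B]
    [StarModule ℂ B] [FiniteDimensional ℂ B] (x : B) (hx : star x = x) :
    ∃ e p q : B, star e = e ∧ e * e = e ∧ e * x = x * e ∧ e * x = star p * p ∧
      (e - 1) * x = star q * q := by
  have : CompleteSpace B := FiniteDimensional.complete ℂ B
  letI : CStarAlgebra B := {}
  exact qg_proj_aux B x hx

/-- `star` is compatible with a positive functional. -/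
lemma qg_star (B : Type*) [Ring B] [StarRing B] [Algebra ℂ B] [StarModule ℂ B]
    (τ : B →ₗ[ℂ] ℂ)
    (hτpos : ∀ x : B, 0 ≤ (τ (star x * x)).re ∧ (τ (star x * x)).im = 0) (x : B) :
    τ (star x) = starRingEnd ℂ (τ x) := by
  have h1 := (hτpos (1 + x)).2
  have h2 := (hτpos (1 + Complex.I • x)).2
  have h3 := (hτpos x).2
  have h4 := (hτpos 1).2
  simp only [star_add, star_one, star_smul, add_mul, mul_add, one_mul, mul_one, map_add,
    map_smul, smul_mul_assoc, mul_smul_comm, smul_smul, Complex.add_im, smul_eq_mul] at h1 h2 h4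
  simp at h2 h4
  apply Complex.ext
  · simp; linarith
  · simp; linarith

/-- Existence of an orthonormal basis for the GNS inner product, as an expansion formula. -/
lemma qg_onb (B : Type*) [Ring B] [StarRing B] [Algebra ℂ B] [StarModule ℂ B]
    [FiniteDimensional ℂ B] (τ : B →ₗ[ℂ] ℂ)
    (hτpos : ∀ x : B, 0 ≤ (τ (star x * x)).re ∧ (τ (star x * x)).im = 0)
    (hτfaith : ∀ x : B, τ (star x * x) = 0 → x = 0) :
    ∃ (n : ℕ) (u : Fin n → B), ∀ x, x = ∑ i, τ (star (u i) * x) • u i := by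
  let cd : InnerProductSpace.Core ℂ B :=
    { inner := fun x y => τ (star x * y)
      conj_inner_symm := fun x y => by
        rw [← qg_star B τ hτpos, star_mul, star_star]
      re_inner_nonneg := fun x => (hτpos x).1
      add_left := fun x y z => by simp [add_mul]
      smul_left := fun x y r => by simp
      definite := fun x h => hτfaith x h }
  letI : NormedAddCommGroup B := cd.toNormedAddCommGroup
  letI : InnerProductSpace ℂ B := InnerProductSpace.ofCore cd.toCore
  let b := stdOrthonormalBasis ℂ B
  exact ⟨_, b, fun x => (b.sum_repr' x).symm⟩

/-- The Kraus-type formula. -/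
lemma qg_pos (B : Type*) [Ring B] [StarRing B] [Algebra ℂ B]
    [StarModule ℂ B] [FiniteDimensional ℂ B]
    (τ : B →ₗ[ℂ] ℂ)
    (hτpos : ∀ x : B, 0 ≤ (τ (star x * x)).re ∧ (τ (star x * x)).im = 0)
    (hτfaith : ∀ x : B, τ (star x * x) = 0 → x = 0)
    (hτtracial : ∀ a b : B, τ (a * b) = τ (b * a))
    (δ : ℝ) (hδ : 0 < δ)
    (mdag : B →ₗ[ℂ] TensorProduct ℂ B B)
    (hmdag : ∀ a b c : B, pairQ B τ (star b) (star c) (mdag a) = τ (star (b * c) * a))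
    (A : B →ₗ[ℂ] B)
    (hSchur : ((δ : ℂ) ^ 2) • A = LinearMap.mul' ℂ B ∘ₗ TensorProduct.map A A ∘ₗ mdag)
    (hreal : ∀ x : B, A (star x) = star (A x)) (x : B) :
    ∃ (n : ℕ) (w : Fin n → B), A (star x * x) = ∑ k, w k * star (w k) := by
  obtain ⟨n, u, hu⟩ := qg_onb B τ hτpos hτfaith
  have hten : ∀ t : TensorProduct ℂ B B,
      t = ∑ i, ∑ j, pairQ B τ (star (u i)) (star (u j)) t • (u i ⊗ₜ[ℂ] u j) := by
    intro t
    induction t using TensorProduct.induction_on with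
    | zero => simp
    | add a b ha hb =>
      simp only [map_add, add_smul, Finset.sum_add_distrib]
      rw [← ha, ← hb]
    | tmul a b =>
      conv_lhs => rw [hu a, hu b]
      simp only [TensorProduct.sum_tmul, TensorProduct.tmul_sum, TensorProduct.smul_tmul_smul]
      rw [Finset.sum_comm]
      simp [pairQ]
  have hpars : ∀ a b : B, τ (a * b) = ∑ k, τ (a * u k) * τ (star (u k) * b) := by
    intro a b
    conv_lhs => rw [hu b]
    simp [Finset.mul_sum, mul_comm]
  have key : ((δ : ℂ) ^ 2) • A (star x * x) = ∑ k, A (star x * u k) * star (A (star x * u k)) := by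
    have h1 := congrArg (fun L : B →ₗ[ℂ] B => L (star x * x)) hSchur
    simp only [LinearMap.smul_apply, LinearMap.comp_apply] at h1
    rw [h1, hten (mdag (star x * x))]
    have h2 : ∀ k, A (star x * u k) * star (A (star x * u k)) =
        ∑ i, ∑ j, (τ (star (u i) * star x * u k) * τ (star (u k) * (x * star (u j)))) •
          (A (u i) * A (u j)) := by
      intro k
      rw [← hreal, star_mul, star_star]
      conv_lhs => rw [hu (star x * u k), hu (star (u k) * x)]
      simp only [map_sum, map_smul, Finset.sum_mul_sum, smul_mul_smul_comm]
      refine Finset.sum_congr rfl fun i _ => Finset.sum_congr rfl fun j _ => ?_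
      rw [hτtracial (star (u j)), mul_assoc, mul_assoc]
    simp only [h2, map_sum, map_smul, TensorProduct.map_tmul, LinearMap.mul'_apply, hmdag]
    symm
    rw [Finset.sum_comm]
    refine Finset.sum_congr rfl fun i _ => ?_
    rw [Finset.sum_comm]
    refine Finset.sum_congr rfl fun j _ => ?_
    rw [← Finset.sum_smul, ← hpars, star_mul, mul_assoc (star (u j)), hτtracial (star (u j))]
    simp only [mul_assoc]
  refine ⟨n, fun k => ((δ : ℂ)⁻¹) • A (star x * u k), ?_⟩
  have hδ' : (δ : ℂ) ≠ 0 := by exact_mod_cast hδ.ne'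
  have h3 : A (star x * x) = ((δ : ℂ)⁻¹ * (δ : ℂ)⁻¹) • (((δ : ℂ) ^ 2) • A (star x * x)) := by
    rw [smul_smul]
    have : (δ : ℂ)⁻¹ * (δ : ℂ)⁻¹ * (δ : ℂ) ^ 2 = 1 := by field_simp
    rw [this, one_smul]
  rw [h3, key, Finset.smul_sum]
  refine Finset.sum_congr rfl fun k _ => ?_
  simp [star_smul, smul_smul]

/-- Compression of a positive element by a projection. -/
lemma qg_compress (B : Type*) [Ring B] [StarRing B] [Algebra ℂ B]
    (τ : B →ₗ[ℂ] ℂ)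
    (hτpos : ∀ x : B, 0 ≤ (τ (star x * x)).re ∧ (τ (star x * x)).im = 0)
    (hτfaith : ∀ x : B, τ (star x * x) = 0 → x = 0)
    (hτtracial : ∀ a b : B, τ (a * b) = τ (b * a))
    (y e : B) (hy : ∃ (n : ℕ) (w : Fin n → B), y = ∑ k, w k * star (w k))
    (he : star e = e) (hee : e * e = e) :
    0 ≤ (τ (e * y)).re ∧ ((τ (e * y)).re = 0 → e * y = 0) := by
  obtain ⟨n, w, rfl⟩ := hy
  have h1 : ∀ k, τ (e * (w k * star (w k))) = τ (star (star (w k) * e) * (star (w k) * e)) := by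
    intro k
    rw [star_mul, star_star, he]
    calc τ (e * (w k * star (w k))) = τ (e * (e * (w k * star (w k)))) := by
          rw [← mul_assoc e e, hee]
      _ = τ ((e * (w k * star (w k))) * e) := hτtracial _ _
      _ = _ := by simp only [mul_assoc]
  have h2 : (τ (e * ∑ k, w k * star (w k))).re =
      ∑ k, (τ (star (star (w k) * e) * (star (w k) * e))).re := by
    rw [Finset.mul_sum, map_sum, Complex.re_sum]
    exact Finset.sum_congr rfl fun k _ => by rw [h1]
  rw [h2]
  refine ⟨Finset.sum_nonneg fun k _ => (hτpos _).1, fun h => ?_⟩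
  rw [Finset.sum_eq_zero_iff_of_nonneg fun k _ => (hτpos _).1] at h
  rw [Finset.mul_sum]
  refine Finset.sum_eq_zero fun k hk => ?_
  have h3 := hτfaith _ (Complex.ext (h k hk) (hτpos _).2)
  have h4 : e * w k = 0 := by
    have := congrArg star h3
    simpa [he] using this
  rw [← mul_assoc, h4, zero_mul]

/-- The star homomorphism `ℂ² → B` attached to a projection. -/
noncomputable def qgHom (B : Type*) [Ring B] [StarRing B] [Algebra ℂ B] [StarModule ℂ B]
    (e : B) (he : star e = e) (hee : e * e = e) : (Fin 2 → ℂ) →⋆ₐ[ℂ] B where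
  toFun v := v 0 • e + v 1 • (1 - e)
  map_one' := by simp
  map_mul' v w := by
    have h1 : e * (1 - e) = 0 := by rw [mul_sub, mul_one, hee, sub_self]
    have h2 : (1 - e) * e = 0 := by rw [sub_mul, one_mul, hee, sub_self]
    have h3 : (1 - e) * (1 - e) = 1 - e := by rw [mul_sub, mul_one, h2, sub_zero]
    simp [add_mul, mul_add, smul_smul, h1, h2, h3, hee, mul_comm]
  map_zero' := by simp
  map_add' v w := by simp only [Pi.add_apply, add_smul]; abel
  commutes' r := by
    simp only [Pi.algebraMap_apply, Algebra.algebraMap_self, RingHom.id_apply]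
    rw [← smul_add, add_sub_cancel, Algebra.algebraMap_eq_smul_one]
  map_star' v := by simp [he]

/-- Let `(B, τ, A)` be a connected `d`-regular undirected tracial
quantum graph.  Then `G` is bipartite — i.e. there is an injective unital
`*`-homomorphism `f : ℂ² → B` with `⟨f eᵢ, A f eᵢ⟩ = 0` for `i = 1, 2` (a surjective
graph homomorphism onto `K₂`) — if and only if `−d ∈ Spec(A)` (where for `d = 0` one
additionally requires `dim B ≥ 2`).  Moreover, in the bipartite case the projections
`x₁ = f e₁`, `x₂ = f e₂` satisfy `τ x₁ = τ x₂ = 1/2`, `A x₁ = d x₂`, `A x₂ = d x₁`,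
and `A (x₁ − x₂) = −d (x₁ − x₂)`. -/
theorem bipartite_iff_minus_d_in_spectrum
    (B : Type*) [NormedRing B] [StarRing B] [CStarRing B] [NormedAlgebra ℂ B]
    [StarModule ℂ B] [FiniteDimensional ℂ B]
    (τ : B →ₗ[ℂ] ℂ)
    (hτ1 : τ 1 = 1)
    (hτpos : ∀ x : B, 0 ≤ (τ (star x * x)).re ∧ (τ (star x * x)).im = 0)
    (hτfaith : ∀ x : B, τ (star x * x) = 0 → x = 0)
    (hτtracial : ∀ a b : B, τ (a * b) = τ (b * a))
    (δ : ℝ) (hδ : 0 < δ)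
    (mdag : B →ₗ[ℂ] TensorProduct ℂ B B)
    (hmdag : ∀ a b c : B, pairQ B τ (star b) (star c) (mdag a) = τ (star (b * c) * a))
    (hδform : LinearMap.mul' ℂ B ∘ₗ mdag = ((δ : ℂ) ^ 2) • LinearMap.id)
    (A : B →ₗ[ℂ] B)
    (hSchur : ((δ : ℂ) ^ 2) • A = LinearMap.mul' ℂ B ∘ₗ TensorProduct.map A A ∘ₗ mdag)
    (hreal : ∀ x : B, A (star x) = star (A x))
    (hsa : ∀ x y : B, τ (star (A x) * y) = τ (star x * A y))
    (d : ℝ)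
    (hreg1 : A 1 = (d : ℂ) • 1)
    (hreg2 : ∀ x : B, τ (A x) = (d : ℂ) * τ x)
    (hconn : Module.finrank ℂ
      (LinearMap.ker ((d : ℂ) • (LinearMap.id : B →ₗ[ℂ] B) - A)) = 1) :
    ((∃ f : (Fin 2 → ℂ) →⋆ₐ[ℂ] B, Function.Injective f ∧
        τ (star (f (Pi.single 0 1)) * A (f (Pi.single 0 1))) = 0 ∧
        τ (star (f (Pi.single 1 1)) * A (f (Pi.single 1 1))) = 0) ↔
      ((-d : ℂ) ∈ spectrum ℂ A ∧ (d = 0 → 2 ≤ Module.finrank ℂ B))) ∧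
    (∀ f : (Fin 2 → ℂ) →⋆ₐ[ℂ] B, Function.Injective f →
        τ (star (f (Pi.single 0 1)) * A (f (Pi.single 0 1))) = 0 →
        τ (star (f (Pi.single 1 1)) * A (f (Pi.single 1 1))) = 0 →
        τ (f (Pi.single 0 1)) = 1 / 2 ∧ τ (f (Pi.single 1 1)) = 1 / 2 ∧
          A (f (Pi.single 0 1)) = (d : ℂ) • f (Pi.single 1 1) ∧
          A (f (Pi.single 1 1)) = (d : ℂ) • f (Pi.single 0 1) ∧
          A (f (Pi.single 0 1) - f (Pi.single 1 1))
            = (-d : ℂ) • (f (Pi.single 0 1) - f (Pi.single 1 1))) := by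
  have hpos : ∀ x : B, ∃ (n : ℕ) (w : Fin n → B), A (star x * x) = ∑ k, w k * star (w k) :=
    qg_pos B τ hτpos hτfaith hτtracial δ hδ mdag hmdag A hSchur hreal
  have hcomp := qg_compress B τ hτpos hτfaith hτtracial
  have hone : (1 : B) ≠ 0 := fun h => by rw [h, map_zero] at hτ1; exact zero_ne_one hτ1
  -- connectedness in usable form
  have hker : ∀ y : B, A y = (d : ℂ) • y → ∃ c : ℂ, y = c • 1 := by
    intro y hy
    have h1 : (1 : B) ∈ LinearMap.ker ((d : ℂ) • (LinearMap.id : B →ₗ[ℂ] B) - A) := by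
      simp [hreg1]
    have h2 : y ∈ LinearMap.ker ((d : ℂ) • (LinearMap.id : B →ₗ[ℂ] B) - A) := by
      simp [hy]
    obtain ⟨c, hc⟩ := (finrank_eq_one_iff_of_nonzero' ⟨(1 : B), h1⟩
      (fun h => hone (congrArg Subtype.val h))).mp hconn ⟨y, h2⟩
    exact ⟨c, (congrArg Subtype.val hc).symm⟩
  -- the "moreover" part, together with `d ≠ 0`
  have hmain : ∀ f : (Fin 2 → ℂ) →⋆ₐ[ℂ] B, Function.Injective f →
        τ (star (f (Pi.single 0 1)) * A (f (Pi.single 0 1))) = 0 →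
        τ (star (f (Pi.single 1 1)) * A (f (Pi.single 1 1))) = 0 →
        d ≠ 0 ∧ A (f (Pi.single 0 1)) = (d : ℂ) • f (Pi.single 1 1) ∧
          A (f (Pi.single 1 1)) = (d : ℂ) • f (Pi.single 0 1) ∧
          f (Pi.single 0 1) + f (Pi.single 1 1) = 1 := by
    intro f hf h0 h1
    have hsum : f (Pi.single 0 1) + f (Pi.single 1 1) = 1 := by
      rw [← map_add, ← map_one f]; congr 1; ext i; fin_cases i <;> simp
    have hst : ∀ i : Fin 2, star (f (Pi.single i 1)) = f (Pi.single i 1) := by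
      intro i; rw [← map_star]; congr 1; ext j; fin_cases i <;> fin_cases j <;> simp
    have hid : ∀ i : Fin 2, f (Pi.single i 1) * f (Pi.single i 1) = f (Pi.single i 1) := by
      intro i; rw [← map_mul]; congr 1; ext j; fin_cases i <;> fin_cases j <;> simp
    have hn : ∀ i : Fin 2, f (Pi.single i 1) ≠ 0 := by
      intro i h
      rw [← map_zero f] at h
      have := congrFun (hf h) i
      simp at this
    have hz : ∀ i : Fin 2, τ (star (f (Pi.single i 1)) * A (f (Pi.single i 1))) = 0 →
        f (Pi.single i 1) * A (f (Pi.single i 1)) = 0 := by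
      intro i hi
      have hp := hpos (f (Pi.single i 1))
      rw [hst, hid] at hp
      rw [hst] at hi
      exact (hcomp _ _ hp (hst i) (hid i)).2 (by rw [hi]; rfl)
    have hz0 := hz 0 h0
    have hz1 := hz 1 h1
    have hx01 : f (Pi.single 0 1) * f (Pi.single 1 1) = 0 := by
      rw [← map_mul, ← map_zero f]; congr 1; ext j; fin_cases j <;> simp
    have hx10 : f (Pi.single 1 1) * f (Pi.single 0 1) = 0 := by
      rw [← map_mul, ← map_zero f]; congr 1; ext j; fin_cases j <;> simp
    have hn1 := hn 1
    have hn0 := hn 0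
    clear hz hn hst hid h0 h1
    generalize f (Pi.single 0 1) = x at *
    generalize f (Pi.single 1 1) = y at *
    have hA : A x + A y = (d : ℂ) • (1 : B) := by rw [← map_add, hsum, hreg1]
    have hAx : A x = (d : ℂ) • y := by
      calc A x = (x + y) * A x := by rw [hsum, one_mul]
        _ = y * A x := by rw [add_mul, hz0, zero_add]
        _ = y * (A x + A y) := by rw [mul_add, hz1, add_zero]
        _ = (d : ℂ) • y := by rw [hA, mul_smul_comm, mul_one]
    have hAy : A y = (d : ℂ) • x := by
      calc A y = (x + y) * A y := by rw [hsum, one_mul]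
        _ = x * A y := by rw [add_mul, hz1, add_zero]
        _ = x * (A x + A y) := by rw [mul_add, hz0, zero_add]
        _ = (d : ℂ) • x := by rw [hA, mul_smul_comm, mul_one]
    refine ⟨?_, hAx, hAy, hsum⟩
    rintro rfl
    obtain ⟨c, hc⟩ := hker x (by rw [hAx]; simp)
    have hcy : c • y = 0 := by
      rw [hc, smul_mul_assoc, one_mul] at hx01
      exact hx01
    rcases smul_eq_zero.mp hcy with h | h
    · exact hn0 (by rw [hc, h, zero_smul])
    · exact hn1 h
  have hdC : d ≠ 0 → (d : ℂ) ≠ 0 := fun h => by exact_mod_cast h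
  refine ⟨⟨?_, ?_⟩, ?_⟩
  · rintro ⟨f, hf, h0, h1⟩
    obtain ⟨hd, hx, hy, hsum⟩ := hmain f hf h0 h1
    refine ⟨?_, fun h => absurd h hd⟩
    have hne : f (Pi.single 0 1) - f (Pi.single 1 1) ≠ 0 := by
      intro h
      rw [← map_sub, ← map_zero f] at h
      have := congrFun (hf h) 0
      simp at this
    have hev : Module.End.HasEigenvalue (A : Module.End ℂ B) (-d : ℂ) := by
      refine Module.End.hasEigenvalue_of_hasEigenvector
        (x := f (Pi.single 0 1) - f (Pi.single 1 1)) ⟨?_, hne⟩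
      rw [Module.End.mem_eigenspace_iff, map_sub, hx, hy]
      module
    exact Module.End.hasEigenvalue_iff_mem_spectrum.mp hev
  · rintro ⟨hspec, hdim⟩
    by_cases hd : d = 0
    · exfalso
      have hA0 : ∀ p : B, A (star p * p) = 0 := by
        intro p
        have := (hcomp _ 1 (hpos p) (star_one B) (one_mul 1)).2
          (by rw [one_mul, hreg2, hd]; simp)
        simpa using this
      have hsa0 : ∀ x : B, star x = x → A x = 0 := by
        intro x hx
        obtain ⟨e, p, q, -, -, -, hp, hq⟩ := qg_proj B x hx
        have : x = star p * p - star q * q := by rw [← hp, ← hq]; noncomm_ring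
        rw [this, map_sub, hA0, hA0, sub_zero]
      have hall : ∀ x : B, A x = 0 := by
        intro x
        have h1 := hsa0 (x + star x) (by rw [star_add, star_star, add_comm])
        have h2 := hsa0 (Complex.I • (x - star x)) (by
          rw [star_smul, star_sub, star_star]; simp [← smul_neg])
        rw [map_smul, smul_eq_zero_iff_right Complex.I_ne_zero, map_sub, sub_eq_zero] at h2
        rw [map_add, ← h2, ← two_smul ℂ, smul_eq_zero_iff_right two_ne_zero] at h1
        exact h1
      have hk : LinearMap.ker ((d : ℂ) • (LinearMap.id : B →ₗ[ℂ] B) - A) = ⊤ := by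
        rw [eq_top_iff]
        intro x _
        simp [hd, hall]
      rw [hk, finrank_top] at hconn
      have := hdim hd
      omega
    · have hd' := hdC hd
      have hev := Module.End.hasEigenvalue_iff_mem_spectrum.mpr hspec
      obtain ⟨z, hz, hz0⟩ := hev.exists_hasEigenvector
      rw [Module.End.mem_eigenspace_iff] at hz
      -- self-adjoint eigenvector
      obtain ⟨x, hx0, hxs, hxA⟩ : ∃ x : B, x ≠ 0 ∧ star x = x ∧ A x = (-d : ℂ) • x := by
        have hzs : A (star z) = (-d : ℂ) • star z := by
          rw [hreal, hz, star_smul]; simp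
        by_cases h : z + star z = 0
        · refine ⟨Complex.I • z, smul_ne_zero Complex.I_ne_zero hz0, ?_, ?_⟩
          · have : star z = -z := by rw [eq_neg_iff_add_eq_zero, add_comm]; exact h
            rw [star_smul, this]; simp
          · rw [map_smul, hz, smul_comm]
        · exact ⟨z + star z, h, by rw [star_add, star_star, add_comm], by
            rw [map_add, hz, hzs, smul_add]⟩
      obtain ⟨e, p, q, hes, hee, hex, hp, hq⟩ := qg_proj B x hxs
      have hef : e * (1 - e) = 0 := by rw [mul_sub, mul_one, hee, sub_self]
      have hfe : (1 - e) * e = 0 := by rw [sub_mul, one_mul, hee, sub_self]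
      have hff : (1 - e) * (1 - e) = 1 - e := by rw [mul_sub, mul_one, hfe, sub_zero]
      have hfs : star (1 - e) = 1 - e := by rw [star_sub, star_one, hes]
      have hpa := hpos p
      have hpb := hpos q
      rw [← hp] at hpa
      rw [← hq] at hpb
      have hea : e * (e * x) = e * x := by rw [← mul_assoc, hee]
      have heb : e * ((e - 1) * x) = 0 := by rw [← mul_assoc, mul_sub, hee, mul_one, sub_self, zero_mul]
      have hxab : x = e * x - (e - 1) * x := by noncomm_ring
      generalize e * x = a at *
      generalize (e - 1) * x = b at *
      have hAab : A a = A b + ((d : ℂ) • b - (d : ℂ) • a) := by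
        have : A a - A b = (-d : ℂ) • (a - b) := by rw [← map_sub, ← hxab, hxA]
        rw [eq_add_of_sub_eq this]; module
      have hfa : (1 - e) * a = 0 := by rw [sub_mul, one_mul, hea, sub_self]
      have hfb : (1 - e) * b = b := by rw [sub_mul, one_mul, heb, sub_zero]
      have hτx : τ a = τ b := by
        have h1 := hreg2 x
        rw [hxA, map_smul, smul_eq_mul] at h1
        have h2 : (2 * (d : ℂ)) * τ x = 0 := by linear_combination -h1
        rcases mul_eq_zero.mp h2 with h | h
        · exact absurd h (mul_ne_zero two_ne_zero hd')
        · rw [hxab, map_sub, sub_eq_zero] at h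
          exact h
      have hfAa : (1 - e) * A a = (1 - e) * A b + (d : ℂ) • b := by
        rw [hAab, mul_add, mul_sub, mul_smul_comm, mul_smul_comm, hfa, hfb, smul_zero, sub_zero]
      have heAa : e * A a = e * A b - (d : ℂ) • a := by
        rw [hAab, mul_add, mul_sub, mul_smul_comm, mul_smul_comm, hea, heb, smul_zero, zero_sub,
          sub_eq_add_neg]
      have htr : τ (e * A a) + τ ((1 - e) * A b) = 0 := by
        have h1 : τ (e * A a) + τ ((1 - e) * A a) = (d : ℂ) * τ a := by
          rw [← map_add, ← add_mul, add_sub_cancel, one_mul, hreg2]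
        rw [hfAa, map_add, map_smul, smul_eq_mul, ← hτx] at h1
        linear_combination h1
      have hc1 := hcomp _ e hpa hes hee
      have hc2 := hcomp _ (1 - e) hpb hfs hff
      have htr' := congrArg Complex.re htr
      rw [Complex.add_re, Complex.zero_re] at htr'
      have hz1 := hc1.2 (by linarith [hc1.1, hc2.1])
      have hz2 := hc2.2 (by linarith [hc1.1, hc2.1])
      have hAa : A a = (d : ℂ) • b := by
        calc A a = e * A a + (1 - e) * A a := by rw [← add_mul, add_sub_cancel, one_mul]
          _ = (d : ℂ) • b := by rw [hz1, hfAa, hz2, zero_add, zero_add]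
      have hAb : A b = (d : ℂ) • a := by
        calc A b = e * A b + (1 - e) * A b := by rw [← add_mul, add_sub_cancel, one_mul]
          _ = (d : ℂ) • a := by
            rw [hz1] at heAa
            rw [hz2, add_zero, ← sub_eq_zero, ← heAa]
      obtain ⟨c, hc⟩ := hker (a + b) (by rw [map_add, hAa, hAb, smul_add, add_comm])
      have hac : a = c • e := by
        have := congrArg (fun t => e * t) hc
        simpa [mul_add, hea, heb] using this
      have hbc : b = c • (1 - e) := by
        have := congrArg (fun t => (1 - e) * t) hc
        simpa only [mul_add, hfa, hfb, zero_add, mul_smul_comm, mul_one] using this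
      have hc0 : c ≠ 0 := by
        rintro rfl
        apply hx0
        rw [hxab, hac, hbc]; simp
      have hAe : A e = (d : ℂ) • (1 - e) := by
        rw [hac, hbc, map_smul, smul_comm] at hAa
        exact smul_right_injective B hc0 hAa
      have hAf : A (1 - e) = (d : ℂ) • e := by
        rw [hac, hbc, map_smul, smul_comm] at hAb
        exact smul_right_injective B hc0 hAb
      have he0 : e ≠ 0 := by
        intro h
        rw [h, map_zero, sub_zero] at hAe
        exact smul_ne_zero hd' hone hAe.symm
      have hf0 : 1 - e ≠ 0 := by
        intro h
        rw [h, map_zero] at hAf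
        exact smul_ne_zero hd' he0 hAf.symm
      have hg : ∀ v, qgHom B e hes hee v = v 0 • e + v 1 • (1 - e) := fun v => rfl
      have hg0 : qgHom B e hes hee (Pi.single 0 1) = e := by simp [hg]
      have hg1 : qgHom B e hes hee (Pi.single 1 1) = 1 - e := by simp [hg]
      refine ⟨qgHom B e hes hee, ?_, ?_, ?_⟩
      · rw [injective_iff_map_eq_zero]
        intro v hv
        rw [hg] at hv
        have h0 := congrArg (fun t => e * t) hv
        have h1 := congrArg (fun t => (1 - e) * t) hv
        simp only [mul_add, mul_smul_comm, hee, hef, hfe, hff, smul_zero, add_zero, zero_add,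
          mul_zero] at h0 h1
        have h0' := (smul_eq_zero.mp h0).resolve_right he0
        have h1' := (smul_eq_zero.mp h1).resolve_right hf0
        ext i
        fin_cases i
        · exact h0'
        · exact h1'
      · rw [hg0, hAe, hes, mul_smul_comm, hef, smul_zero, map_zero]
      · rw [hg1, hAf, hfs, mul_smul_comm, hfe, smul_zero, map_zero]
  · intro f hf h0 h1
    obtain ⟨hd, hx, hy, hsum⟩ := hmain f hf h0 h1
    have hd' := hdC hd
    have hτe : τ (f (Pi.single 0 1)) = τ (f (Pi.single 1 1)) := by
      have := hreg2 (f (Pi.single 0 1))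
      rw [hx, map_smul, smul_eq_mul] at this
      exact (mul_left_cancel₀ hd' this).symm
    have hτs : τ (f (Pi.single 0 1)) + τ (f (Pi.single 1 1)) = 1 := by
      rw [← map_add, hsum, hτ1]
    refine ⟨?_, ?_, hx, hy, ?_⟩
    · rw [← hτe] at hτs; linear_combination hτs / 2
    · rw [hτe] at hτs; linear_combination hτs / 2
    · rw [map_sub, hx, hy]; module
end
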